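/- arXiv:1904.04157 — 2 statements merged into one kernel-verified Lean document; each statement's English description precedes it below -/
import Mathlib

section
/- (Sylvester criterion for m-positive matrices, chain form.) Let S be a real symmetric n×n matrix, 1 ≤ m ≤ n, and fix pairwise distinct indices i₁, i₂, …, i_{m−1} in {1, …, n}. For 1 ≤ k ≤ m−1 let S^{⟨i₁,…,i_k⟩} denote the symmetric (n−k)×(n−k) matrix obtained from S by deleting the rows and columns with numbers i₁, …, i_k. Then S ∈ K_m(n) if and only if T_m(S) > 0, T_{m−1}(S^{⟨i₁⟩}) > 0, T_{m−2}(S^{⟨i₁,i₂⟩}) > 0, …, and T_1(S^{⟨i₁,…,i_{m−1}⟩}) > 0. -/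
open Matrix

/-- The `p`-trace of a square real matrix: the sum of all `p × p` principal minors.
    `ptrace 0 S = 1`. -/
noncomputable def ptrace {ι : Type*} [Fintype ι] (p : ℕ) (S : Matrix ι ι ℝ) : ℝ := by
  classical
  exact ∑ t ∈ Finset.univ.powersetCard p,
    (S.submatrix (Subtype.val : {x // x ∈ t} → ι) Subtype.val).det

/-- The Gårding cone `K_m(n)`: real symmetric `n × n` matrices with `T_p > 0`
    for `p = 1, …, m`. -/
noncomputable def gardingCone (n m : ℕ) : Set (Matrix (Fin n) (Fin n) ℝ) :=
  {S | S.IsSymm ∧ ∀ p, 1 ≤ p → p ≤ m → 0 < ptrace p S}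

open scoped Classical

open Finset Polynomial in
/-- The derivative of a real-rooted polynomial is real-rooted. -/
lemma Polynomial.Splits.derivative_of_real {p : ℝ[X]} (hp : p.Splits) :
    (derivative p).Splits := by
  rw [splits_iff_card_roots] at hp ⊢
  have h1 := card_roots_le_derivative p
  have h2 := natDegree_derivative_le p
  have h3 := card_roots' (derivative p)
  omega

open Finset Polynomial in
/-- A real-rooted polynomial with nonnegative coefficients and positive constant coefficient
has only positive coefficients. -/
lemma Polynomial.Splits.coeff_pos {p : ℝ[X]} (hp : p.Splits) (hnonneg : ∀ k, 0 ≤ p.coeff k)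
    (h0 : 0 < p.coeff 0) {k : ℕ} (hk : k ≤ p.natDegree) : 0 < p.coeff k := by
  have hp0 : p ≠ 0 := by rintro rfl; simp at h0
  have hcard := splits_iff_card_roots.1 hp
  have hneg : ∀ r ∈ p.roots, r < 0 := by
    intro r hr
    by_contra! hr0
    have hev : p.eval r = 0 := (mem_roots hp0).1 hr
    rw [eval_eq_sum_range, sum_range_succ'] at hev
    have : 0 ≤ ∑ k ∈ range p.natDegree, p.coeff (k + 1) * r ^ (k + 1) :=
      sum_nonneg fun k _ => mul_nonneg (hnonneg _) (pow_nonneg hr0 _)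
    simp only [pow_zero, mul_one] at hev
    linarith
  rw [coeff_eq_esymm_roots_of_card hcard hk, mul_assoc, ← Multiset.esymm_neg]
  have hlead : 0 < p.leadingCoeff :=
    lt_of_le_of_ne (hnonneg _) (leadingCoeff_ne_zero.2 hp0).symm
  refine mul_pos hlead ?_
  have hle : p.natDegree - k ≤ Multiset.card (p.roots.map Neg.neg) := by
    rw [Multiset.card_map]; omega
  obtain ⟨s, hs⟩ := Multiset.card_pos_iff_exists_mem.1
    ((Nat.choose_pos hle).trans_eq (Multiset.card_powersetCard _ _).symm)
  have hpos : ∀ t ∈ Multiset.powersetCard (p.natDegree - k) (p.roots.map Neg.neg),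
      0 < t.prod := by
    intro t ht
    refine Multiset.prod_pos fun x hx => ?_
    obtain ⟨r, hr, rfl⟩ :=
      Multiset.mem_map.1 (Multiset.mem_of_le (Multiset.mem_powersetCard.1 ht).1 hx)
    exact neg_pos.2 (hneg r hr)
  have hmem : s.prod ∈ (Multiset.powersetCard (p.natDegree - k)
      (p.roots.map Neg.neg)).map Multiset.prod :=
    Multiset.mem_map_of_mem _ hs
  refine (hpos s hs).trans_le
    (Multiset.single_le_sum ?_ _ hmem)
  intro x hx
  obtain ⟨t, ht, rfl⟩ := Multiset.mem_map.1 hx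
  exact (hpos t ht).le

section MinorSum

open Finset

variable {ι : Type*} [DecidableEq ι]

/-- The sum of all `p × p` principal minors of `S` with index set contained in `U`. -/
noncomputable def minorSum (S : Matrix ι ι ℝ) (U : Finset ι) (p : ℕ) : ℝ :=
  ∑ t ∈ U.powersetCard p, (S.submatrix (Subtype.val : {x // x ∈ t} → ι) Subtype.val).det

lemma minorSum_zero (S : Matrix ι ι ℝ) (U : Finset ι) : minorSum S U 0 = 1 := by
  simp [minorSum]

lemma minorSum_eq_zero_of_card_lt (S : Matrix ι ι ℝ) {U : Finset ι} {p : ℕ} (h : U.card < p) :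
    minorSum S U p = 0 := by
  simp [minorSum, powersetCard_eq_empty.2 h]

lemma minorSum_map {κ : Type*} [DecidableEq κ] (f : κ ↪ ι) (S : Matrix ι ι ℝ) (U : Finset κ)
    (p : ℕ) : minorSum S (U.map f) p = minorSum (S.submatrix f f) U p := by
  rw [minorSum, minorSum, powersetCard_map, sum_map]
  refine sum_congr rfl fun t _ => ?_
  let e : {x // x ∈ t} ≃ {x // x ∈ t.map f} :=
    Equiv.ofBijective (fun x => ⟨f x, mem_map_of_mem f x.2⟩) (by
      constructor
      · intro x y h
        exact Subtype.ext (f.injective (congrArg Subtype.val h))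
      · rintro ⟨y, hy⟩
        obtain ⟨x, hx, rfl⟩ := mem_map.1 hy
        exact ⟨⟨x, hx⟩, rfl⟩)
  exact (det_submatrix_equiv_self e
    (S.submatrix (Subtype.val : {x // x ∈ t.map f} → ι) Subtype.val)).symm

lemma ptrace_eq_minorSum [Fintype ι] (S : Matrix ι ι ℝ) (p : ℕ) :
    ptrace p S = minorSum S univ p := by
  unfold ptrace minorSum
  congr!

lemma ptrace_submatrix_eq_minorSum [Fintype ι] (S : Matrix ι ι ℝ) (P : ι → Prop)
    [Fintype {x // P x}] (U : Finset ι) (hU : ∀ x, x ∈ U ↔ P x) (p : ℕ) :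
    ptrace p (S.submatrix (Subtype.val : {x // P x} → ι) Subtype.val) = minorSum S U p := by
  rw [ptrace_eq_minorSum]
  have : U = univ.map (Function.Embedding.subtype P) := by
    ext x; simp [hU]
  rw [this, minorSum_map]
  rfl

lemma minorSum_neg (S : Matrix ι ι ℝ) (U : Finset ι) (p : ℕ) :
    minorSum (-S) U p = (-1) ^ p * minorSum S U p := by
  rw [minorSum, minorSum, mul_sum]
  refine sum_congr rfl fun t ht => ?_
  rw [submatrix_neg, Pi.neg_apply, Pi.neg_apply, det_neg, Fintype.card_coe,
    (mem_powersetCard.1 ht).2]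

lemma det_submatrix_add_single_of_mem [Fintype ι] (S : Matrix ι ι ℝ) (s : ℝ) {i : ι}
    {t : Finset ι} (hi : i ∈ t) :
    ((S + Matrix.single i i s).submatrix (Subtype.val : {x // x ∈ t} → ι) Subtype.val).det =
      (S.submatrix (Subtype.val : {x // x ∈ t} → ι) Subtype.val).det +
        s * (S.submatrix (Subtype.val : {x // x ∈ t.erase i} → ι) Subtype.val).det := by
  simp only [← det_piecewise_one_eq_submatrix_det]
  set A : Matrix ι ι ℝ := Matrix.of (t.piecewise S.row (1 : Matrix ι ι ℝ).row) with hA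
  have h1 : Matrix.of (t.piecewise (S + Matrix.single i i s).row (1 : Matrix ι ι ℝ).row) =
      A.updateRow i (A i + s • (1 : Matrix ι ι ℝ) i) := by
    ext a b
    by_cases hai : a = i
    · subst hai
      by_cases hab : a = b
      · subst hab
        simp [hA, hi, Finset.piecewise, Matrix.row]
      · simp [hA, hi, Finset.piecewise, hab]
    · have hia : i ≠ a := Ne.symm hai
      by_cases hat : a ∈ t <;> simp [hA, Finset.piecewise, Matrix.updateRow_ne hai, hat, hia]
  have h2 : Matrix.of ((t.erase i).piecewise S.row (1 : Matrix ι ι ℝ).row) =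
      A.updateRow i ((1 : Matrix ι ι ℝ) i) := by
    ext a b
    by_cases hai : a = i
    · subst hai
      simp [Finset.piecewise]
    · simp [hA, Finset.piecewise, hai]
  rw [h1, h2, det_updateRow_add, det_updateRow_smul, Matrix.updateRow_eq_self]

lemma minorSum_add_single_of_notMem (S : Matrix ι ι ℝ) (s : ℝ) {i : ι} {U : Finset ι}
    (hi : i ∉ U) (p : ℕ) : minorSum (S + Matrix.single i i s) U p = minorSum S U p := by
  refine sum_congr rfl fun t ht => ?_
  congr 1
  ext a b
  have : i ≠ a := fun h => hi ((mem_powersetCard.1 ht).1 (h ▸ a.2))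
  simp [this]

/-- The `p`-traces are affine in each diagonal entry, with slope the trace of order one less of the
matrix with the corresponding row and column deleted. -/
lemma minorSum_add_single [Fintype ι] (S : Matrix ι ι ℝ) (s : ℝ) {i : ι} {U : Finset ι}
    (hi : i ∈ U) (p : ℕ) :
    minorSum (S + Matrix.single i i s) U (p + 1) =
      minorSum S U (p + 1) + s * minorSum S (U.erase i) p := by
  have hdecomp : ∀ M : Matrix ι ι ℝ, minorSum M U (p + 1) = minorSum M (U.erase i) (p + 1) +
      ∑ t ∈ (U.erase i).powersetCard p,
        (M.submatrix (Subtype.val : {x // x ∈ insert i t} → ι) Subtype.val).det := by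
    intro M
    have hnot : ∀ q, ∀ t ∈ (U.erase i).powersetCard q, i ∉ t := fun q t ht h =>
      notMem_erase i U ((mem_powersetCard.1 ht).1 h)
    conv_lhs => rw [← insert_erase hi]
    rw [minorSum, powersetCard_succ_insert (notMem_erase i U), sum_union, sum_image]
    · rfl
    · intro t ht t' ht' h
      rw [← erase_insert (hnot p t ht), ← erase_insert (hnot p t' ht'), h]
    · rw [disjoint_left]
      intro t ht ht'
      obtain ⟨t', _, rfl⟩ := mem_image.1 ht'
      exact hnot _ _ ht (mem_insert_self i t')
  rw [hdecomp, hdecomp S, minorSum_add_single_of_notMem S s (notMem_erase i U), add_assoc,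
    minorSum, minorSum, mul_sum, ← sum_add_distrib]
  congr 1
  refine sum_congr rfl fun t ht => ?_
  have hit : i ∉ t := fun h => notMem_erase i U ((mem_powersetCard.1 ht).1 h)
  rw [det_submatrix_add_single_of_mem S s (mem_insert_self i t), erase_insert hit]

open Polynomial in
/-- For a symmetric matrix, nonnegative `p`-traces up to order `m` with the last one positive are
all positive. -/
lemma minorSum_pos_of_nonneg {S : Matrix ι ι ℝ} (hS : S.IsSymm) {U : Finset ι} {m : ℕ}
    (hnonneg : ∀ q ≤ m, 0 ≤ minorSum S U q) (hm : 0 < minorSum S U m) :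
    ∀ q ≤ m, 0 < minorSum S U q := by
  intro q hq
  have hmU : m ≤ U.card := by
    by_contra! h
    rw [minorSum_eq_zero_of_card_lt S h] at hm
    exact hm.false
  set A : Matrix {x // x ∈ U} {x // x ∈ U} ℝ := -S.submatrix Subtype.val Subtype.val with hA
  have hAH : A.IsHermitian := by
    ext a b
    simp [hA, hS.apply]
  have hcoeff : ∀ k ≤ U.card, A.charpoly.coeff (U.card - k) = minorSum S U k := by
    intro k hk
    have h1 := A.charpoly_coeff_eq_sum_minors k (by simpa using hk)
    rw [Fintype.card_coe] at h1
    have h2 := minorSum_map (Function.Embedding.subtype (· ∈ U)) S univ k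
    have h3 : univ.map (Function.Embedding.subtype (· ∈ U)) = U := by
      ext x; simp
    rw [h3] at h2
    rw [h1, h2]
    have h4 : (-1) ^ k * minorSum A univ k =
        minorSum (S.submatrix (Function.Embedding.subtype (· ∈ U))
          (Function.Embedding.subtype (· ∈ U))) univ k := by
      rw [hA, minorSum_neg, ← mul_assoc, ← mul_pow]
      simp
    exact h4
  set F : ℝ[X] := derivative^[U.card - m] A.charpoly with hF
  have hFsplits : F.Splits := by
    rw [hF]
    generalize U.card - m = d
    induction d with
    | zero => exact hAH.splits_charpoly
    | succ d ih => rw [Function.iterate_succ_apply']; exact ih.derivative_of_real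
  have hFcoeff : ∀ k ≤ m, F.coeff (m - k) =
      ((m - k + (U.card - m)).descFactorial (U.card - m) : ℝ) * minorSum S U k := by
    intro k hk
    rw [hF, coeff_iterate_derivative, nsmul_eq_mul, ← hcoeff k (hk.trans hmU)]
    congr 2
    omega
  have hfac : ∀ k : ℕ,
      (0 : ℝ) < ((m - k + (U.card - m)).descFactorial (U.card - m) : ℝ) := fun k =>
    Nat.cast_pos.2 (Nat.descFactorial_pos.2 (Nat.le_add_left _ _))
  have hdeg : A.charpoly.natDegree = U.card := by
    rw [charpoly_natDegree_eq_dim, Fintype.card_coe]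
  have hFdeg : F.natDegree ≤ m := by
    have := natDegree_iterate_derivative A.charpoly (U.card - m)
    rw [← hF] at this
    omega
  have hFm : F.natDegree = m := by
    refine le_antisymm hFdeg (le_natDegree_of_ne_zero ?_)
    have := hFcoeff 0 (Nat.zero_le m)
    rw [minorSum_zero, mul_one, Nat.sub_zero] at this
    rw [this]
    exact (hfac 0).ne'
  have hpos := hFsplits.coeff_pos (k := m - q) (fun k => ?_) ?_ (by omega)
  · rw [hFcoeff q hq] at hpos
    exact pos_of_mul_pos_right hpos (hfac q).le
  · rcases le_or_gt k m with hk | hk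
    · have := hFcoeff (m - k) (Nat.sub_le _ _)
      rw [Nat.sub_sub_self hk] at this
      rw [this]
      exact mul_nonneg (Nat.cast_nonneg _) (hnonneg _ (Nat.sub_le _ _))
    · rw [coeff_eq_zero_of_natDegree_lt (hFdeg.trans_lt hk)]
  · have := hFcoeff m le_rfl
    rw [Nat.sub_self] at this
    rw [this]
    have h := hfac m
    rw [Nat.sub_self] at h
    exact mul_pos h hm

lemma isSymm_add_single {S : Matrix ι ι ℝ} (hS : S.IsSymm) (i : ι) (s : ℝ) :
    (S + Matrix.single i i s).IsSymm :=
  hS.add (by simp [Matrix.IsSymm])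

/-- If the matrix with one row and column deleted is `m`-positive and the `(m+1)`-trace is positive
then the matrix is `(m+1)`-positive. -/
lemma minorSum_pos_of_erase [Fintype ι] {S : Matrix ι ι ℝ} (hS : S.IsSymm) {U : Finset ι} {i : ι}
    (hi : i ∈ U) {m : ℕ} (herase : ∀ q ≤ m, 0 < minorSum S (U.erase i) q)
    (hm : 0 < minorSum S U (m + 1)) : ∀ q ≤ m + 1, 0 < minorSum S U q := by
  obtain ⟨p, hp, hmax⟩ := (range (m + 1)).exists_max_image
    (fun p => -minorSum S U (p + 1) / minorSum S (U.erase i) p) (by simp)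
  set s : ℝ := -minorSum S U (p + 1) / minorSum S (U.erase i) p with hs
  have hpm : p ≤ m := Nat.lt_succ_iff.1 (mem_range.1 hp)
  have hle : ∀ q ≤ m, 0 ≤ minorSum S U (q + 1) + s * minorSum S (U.erase i) q := by
    intro q hq
    have := (div_le_iff₀ (herase q hq)).1 (hmax q (mem_range.2 (Nat.lt_succ_iff.2 hq)))
    linarith
  rcases lt_or_ge s 0 with hs0 | hs0
  · rintro (_ | q) hq
    · simp [minorSum_zero]
    · have h1 := hle q (by omega)
      have h2 := mul_neg_of_neg_of_pos hs0 (herase q (by omega))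
      linarith
  · exfalso
    have hpos := minorSum_pos_of_nonneg (isSymm_add_single hS i s) (U := U) (m := m + 1)
      (by
        rintro (_ | q) hq
        · simp [minorSum_zero]
        · rw [minorSum_add_single S s hi]
          exact hle q (by omega))
      (by
        rw [minorSum_add_single S s hi]
        exact add_pos_of_pos_of_nonneg hm (mul_nonneg hs0 (herase m le_rfl).le))
      (p + 1) (by omega)
    rw [minorSum_add_single S s hi, hs, div_mul_cancel₀ _ (herase p hpm).ne'] at hpos
    linarith

/-- Deleting a row and column of an `(m+1)`-positive matrix gives an `m`-positive matrix. -/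
lemma minorSum_erase_pos [Fintype ι] {S : Matrix ι ι ℝ} (hS : S.IsSymm) {U : Finset ι} {i : ι}
    (hi : i ∈ U) {m : ℕ} (h : ∀ q ≤ m + 1, 0 < minorSum S U q) :
    ∀ q ≤ m, 0 < minorSum S (U.erase i) q := by
  induction m with
  | zero =>
    intro q hq
    rw [Nat.le_zero.1 hq, minorSum_zero]
    exact one_pos
  | succ m ih =>
    have herase := ih fun q hq => h q (by omega)
    intro q hq
    rcases Nat.lt_or_eq_of_le hq with hq | rfl
    · exact herase q (by omega)
    by_contra! hneg
    obtain ⟨p, hp, hmin⟩ := (range (m + 1)).exists_min_image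
      (fun p => minorSum S U (p + 1) / minorSum S (U.erase i) p) (by simp)
    set s : ℝ := minorSum S U (p + 1) / minorSum S (U.erase i) p with hs
    have hpm : p ≤ m := Nat.lt_succ_iff.1 (mem_range.1 hp)
    have hs0 : 0 < s := div_pos (h _ (by omega)) (herase p hpm)
    have hlast : 0 < minorSum S U (m + 2) + -s * minorSum S (U.erase i) (m + 1) := by
      have h1 := h (m + 2) le_rfl
      have h2 := mul_nonpos_of_nonneg_of_nonpos hs0.le hneg
      linarith
    have hpos := minorSum_pos_of_nonneg (isSymm_add_single hS i (-s)) (U := U) (m := m + 2)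
      (by
        rintro (_ | q) hq
        · simp [minorSum_zero]
        · rw [minorSum_add_single S (-s) hi]
          rcases Nat.lt_or_eq_of_le hq with hq | hq
          · have := (le_div_iff₀ (herase q (by omega))).1
              (hmin q (mem_range.2 (by omega)))
            linarith
          · obtain rfl : q = m + 1 := by omega
            exact hlast.le)
      (by
        rw [minorSum_add_single S (-s) hi]
        exact hlast)
      (p + 1) (by omega)
    rw [minorSum_add_single S (-s) hi, hs, neg_mul, div_mul_cancel₀ _ (herase p hpm).ne'] at hpos
    linarith

end MinorSum

/-- Sylvester criterion, chain form: let `S` be real symmetric `n × n`,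
`1 ≤ m ≤ n`, and let `i₁, …, i_{m-1}` be pairwise distinct indices (given by an injective
map `idx : Fin (m-1) → Fin n`). For `1 ≤ k ≤ m-1`, `S^{⟨i₁,…,i_k⟩}` is the principal
submatrix of `S` on the complement of `{i₁, …, i_k}`. Then `S ∈ K_m(n)` iff
`T_m(S) > 0` and `T_{m-k}(S^{⟨i₁,…,i_k⟩}) > 0` for every `1 ≤ k ≤ m-1`. -/
theorem sylvester_criterion_chain (n m : ℕ) (h1 : 1 ≤ m) (h2 : m ≤ n)
    (S : Matrix (Fin n) (Fin n) ℝ) (hS : S.IsSymm)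
    (idx : Fin (m - 1) → Fin n) (hidx : Function.Injective idx) :
    S ∈ gardingCone n m ↔
      (0 < ptrace m S ∧
        ∀ k : ℕ, 1 ≤ k → k ≤ m - 1 →
          0 < ptrace (m - k)
            (S.submatrix
              (Subtype.val :
                {x : Fin n // ∀ j : Fin (m - 1), (j : ℕ) < k → idx j ≠ x} → Fin n)
              Subtype.val)) := by
  set U : ℕ → Finset (Fin n) := fun k =>
    Finset.univ.filter fun x => ∀ j : Fin (m - 1), (j : ℕ) < k → idx j ≠ x with hU
  have hsub : ∀ k p : ℕ, ptrace p (S.submatrix (Subtype.val :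
      {x : Fin n // ∀ j : Fin (m - 1), (j : ℕ) < k → idx j ≠ x} → Fin n) Subtype.val) =
      minorSum S (U k) p := fun k p =>
    ptrace_submatrix_eq_minorSum S _ (U k) (fun x => by simp [hU]) p
  have hU0 : U 0 = Finset.univ := by simp [hU]
  have hmem : ∀ k (hk : k < m - 1), idx ⟨k, hk⟩ ∈ U k := by
    intro k hk
    simp only [hU, Finset.mem_filter, Finset.mem_univ, true_and]
    intro j hj h
    have := congrArg Fin.val (hidx h)
    simp only at this
    omega
  have hUsucc : ∀ k (hk : k < m - 1), U (k + 1) = (U k).erase (idx ⟨k, hk⟩) := by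
    intro k hk
    ext x
    simp only [hU, Finset.mem_filter, Finset.mem_univ, true_and, Finset.mem_erase]
    constructor
    · exact fun h => ⟨(h ⟨k, hk⟩ (Nat.lt_succ_self k)).symm, fun j hj => h j (by omega)⟩
    · rintro ⟨hx, h⟩ j hj
      rcases Nat.lt_or_eq_of_le (Nat.lt_succ_iff.1 hj) with hj | hj
      · exact h j hj
      · obtain rfl : j = ⟨k, hk⟩ := Fin.ext hj
        exact hx.symm
  simp only [gardingCone, Set.mem_ofPred_eq, hsub, ptrace_eq_minorSum, ← hU0]
  constructor
  · rintro ⟨-, hpos⟩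
    have hcone : ∀ k ≤ m - 1, ∀ q ≤ m - k, 0 < minorSum S (U k) q := by
      intro k
      induction k with
      | zero =>
        rintro - (_ | q) hq
        · simp [minorSum_zero]
        · exact hpos _ (by omega) (by omega)
      | succ k ih =>
        intro hk
        rw [hUsucc k (by omega)]
        refine minorSum_erase_pos hS (hmem k (by omega)) fun q hq => ?_
        exact ih (by omega) q (by omega)
    exact ⟨hcone 0 (Nat.zero_le _) m le_rfl, fun k _ hk => hcone k hk _ le_rfl⟩
  · rintro ⟨hm, hpos⟩
    have htop : ∀ k ≤ m - 1, 0 < minorSum S (U k) (m - k) := by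
      rintro (_ | k) hk
      · exact hm
      · exact hpos _ (by omega) hk
    have hcone : ∀ d k, k + d = m - 1 → ∀ q ≤ d + 1, 0 < minorSum S (U k) q := by
      intro d
      induction d with
      | zero =>
        rintro k hk (_ | q) hq
        · simp [minorSum_zero]
        · have := htop k (by omega)
          rwa [show m - k = q + 1 by omega] at this
      | succ d ih =>
        intro k hk
        have hk' : k < m - 1 := by omega
        refine minorSum_pos_of_erase hS (hmem k hk') ?_ ?_
        · rw [← hUsucc k hk']
          exact ih (k + 1) (by omega)
        · have := htop k (by omega)
          rwa [show m - k = d + 1 + 1 by omega] at this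
    exact ⟨hS, fun p _ hp => hcone (m - 1) 0 (by omega) p (by omega)⟩
end

section
/- (Modified Sylvester criterion, chain form.) Let S be a real symmetric n×n matrix and 1 ≤ m ≤ n. Suppose {A_k}_{k=1}^{m−1} is a collection of real matrices where A_k has size (n−k+1)×(n−k) and satisfies A_kᵀA_k = I_{n−k}. Define S_0 = S and S_k = A_kᵀ S_{k−1} A_k, a symmetric (n−k)×(n−k) matrix. Then S ∈ K_m(n) if and only if T_m(S) > 0, T_{m−1}(S_1) > 0, T_{m−2}(S_2) > 0, …, and T_1(S_{m−1}) > 0. -/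
open Matrix

section

open Polynomial

theorem Polynomial.Splits.derivative_real {f : ℝ[X]} (hf : f.Splits) : f.derivative.Splits := by
  rw [splits_iff_card_roots] at hf ⊢
  refine le_antisymm (card_roots' _) ?_
  have h1 := card_roots_le_derivative f
  have h2 := natDegree_derivative_le f
  omega

theorem Polynomial.Splits.iterate_derivative_real {f : ℝ[X]} (hf : f.Splits) (k : ℕ) :
    (derivative^[k] f).Splits := by
  induction k with
  | zero => exact hf
  | succ k ih => rw [Function.iterate_succ_apply']; exact ih.derivative_real

/-- The lowest Newton inequality for a product of real linear factors, together with its strict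
form. -/
theorem newton_low_prod_X_sub_C (m : Multiset ℝ) :
    let f : ℝ[X] := (m.map (X - C ·)).prod
    2 * f.coeff 0 * f.coeff 2 ≤ f.coeff 1 ^ 2 ∧
      (f.coeff 0 ≠ 0 → m ≠ 0 → 2 * f.coeff 0 * f.coeff 2 < f.coeff 1 ^ 2) := by
  induction m using Multiset.induction_on with
  | empty => simp [coeff_one]
  | cons r m ih =>
    obtain ⟨ih, -⟩ := ih
    simp only [Multiset.map_cons, Multiset.prod_cons]
    set g : ℝ[X] := (m.map (X - C ·)).prod
    have h0 : ((X - C r) * g).coeff 0 = -r * g.coeff 0 := by simp [mul_coeff_zero]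
    have h1 : ((X - C r) * g).coeff 1 = g.coeff 0 - r * g.coeff 1 := by
      simp [sub_mul]
    have h2 : ((X - C r) * g).coeff 2 = g.coeff 1 - r * g.coeff 2 := by
      simp [sub_mul]
    rw [h0, h1, h2]
    have key := mul_nonneg (sq_nonneg r) (sub_nonneg.2 ih)
    refine ⟨by nlinarith [sq_nonneg (g.coeff 0)], fun hg _ => ?_⟩
    have : 0 < g.coeff 0 ^ 2 := by
      have := right_ne_zero_of_mul hg
      positivity
    nlinarith

theorem Polynomial.Splits.newton_low {f : ℝ[X]} (hf : f.Splits) :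
    2 * f.coeff 0 * f.coeff 2 ≤ f.coeff 1 ^ 2 := by
  obtain ⟨m, hm⟩ := splits_iff_exists_multiset.1 hf
  have h := (newton_low_prod_X_sub_C m).1
  rw [hm]
  simp only [coeff_C_mul]
  nlinarith [mul_nonneg (sq_nonneg f.leadingCoeff) (sub_nonneg.2 h)]

theorem Polynomial.Splits.natDegree_eq_zero_of_coeff_one_two {f : ℝ[X]} (hf : f.Splits)
    (h0 : f.coeff 0 ≠ 0) (h1 : f.coeff 1 = 0) (h2 : f.coeff 2 = 0) : f.natDegree = 0 := by
  obtain ⟨m, hm⟩ := splits_iff_exists_multiset.1 hf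
  have h := (newton_low_prod_X_sub_C m).2
  rw [hm] at h0 h1 h2
  simp only [coeff_C_mul, mul_ne_zero_iff, mul_eq_zero] at h0 h1 h2
  obtain rfl : m = 0 := by
    by_contra hne
    have := h h0.2 hne
    simp [h1.resolve_left h0.1, h2.resolve_left h0.1] at this
  rw [hm]
  simp

/-- Two consecutive vanishing coefficients of a real-rooted polynomial that does not vanish at `0`
force all later coefficients to vanish. -/
theorem Polynomial.Splits.coeff_eq_zero_of_consecutive {f : ℝ[X]} (hf : f.Splits)
    (h0 : f.coeff 0 ≠ 0) (j : ℕ) (h1 : f.coeff j = 0) (h2 : f.coeff (j + 1) = 0)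
    {l : ℕ} (hl : j ≤ l) : f.coeff l = 0 := by
  induction j with
  | zero => exact absurd h1 h0
  | succ j ih =>
    by_cases hj : f.coeff j = 0
    · exact ih hj h1 (by omega)
    have hd : (derivative^[j] f).natDegree = 0 := by
      apply (hf.iterate_derivative_real j).natDegree_eq_zero_of_coeff_one_two
      · rw [coeff_iterate_derivative]
        simp [hj, Nat.descFactorial_eq_zero_iff_lt]
      · rw [coeff_iterate_derivative, add_comm, h1, smul_zero]
      · rw [coeff_iterate_derivative, add_comm, h2, smul_zero]
    have := coeff_eq_zero_of_natDegree_lt (p := derivative^[j] f) (n := l - j) (by omega)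
    rw [coeff_iterate_derivative, Nat.sub_add_cancel (by omega), smul_eq_zero] at this
    refine this.resolve_left fun h => ?_
    rw [Nat.descFactorial_eq_zero_iff_lt] at h
    omega

theorem Polynomial.Splits.coeff_add_two_nonpos {f : ℝ[X]} (hf : f.Splits)
    (h0 : f.coeff 0 ≠ 0) {j : ℕ} (hj : 0 ≤ f.coeff j) (hj1 : f.coeff (j + 1) = 0) :
    f.coeff (j + 2) ≤ 0 := by
  rcases hj.eq_or_lt with hj | hj
  · exact (hf.coeff_eq_zero_of_consecutive h0 j hj.symm hj1 (by omega)).le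
  have h := (hf.iterate_derivative_real j).newton_low
  simp only [coeff_iterate_derivative, zero_add, add_comm 1 j, add_comm 2 j, hj1, smul_zero,
    nsmul_eq_mul] at h
  have d0 : 0 < ((j.descFactorial j : ℕ) : ℝ) := by
    exact_mod_cast Nat.descFactorial_pos.2 le_rfl
  have d2 : 0 < (((j + 2).descFactorial j : ℕ) : ℝ) := by
    exact_mod_cast Nat.descFactorial_pos.2 (by omega)
  by_contra! hc
  have := mul_pos (mul_pos d0 hj) (mul_pos d2 hc)
  nlinarith

section Pencil

variable {a b : ℕ → ℝ} {F : ℝ → ℝ[X]}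

/-- In an affine pencil `a + s b` of coefficient sequences of real-rooted polynomials, the
quotients `a j / b j` are antitone as long as `b` is positive. -/
theorem pencil_mul_le_mul (hF : ∀ s, (F s).Splits) (hc : ∀ s j, (F s).coeff j = a j + s * b j)
    (ha0 : a 0 = 1) (hb0 : b 0 = 0) (hb1 : b 1 = 1) (j : ℕ)
    (hb : ∀ i, 1 ≤ i → i ≤ j → 0 < b i) : a (j + 1) * b j ≤ a j * b (j + 1) := by
  induction j with
  | zero => simp [ha0, hb0, hb1]
  | succ j ih =>
    have ih := ih fun i h1 h2 => hb i h1 (by omega)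
    have hbj := hb (j + 1) (by omega) le_rfl
    have h := (hF (-a (j + 1) / b (j + 1))).coeff_add_two_nonpos (j := j)
      (by simp [hc, ha0, hb0]) ?_ ?_
    · rw [hc, div_mul_eq_mul_div, ← sub_nonneg] at h
      have := mul_nonneg h hbj.le
      field_simp at this
      linarith
    · rw [hc]
      have : a j + -a (j + 1) / b (j + 1) * b j
          = (a j * b (j + 1) - a (j + 1) * b j) / b (j + 1) := by
        field_simp
        ring
      rw [this]
      exact div_nonneg (by linarith) hbj.le
    · rw [hc]
      field_simp
      ring

theorem pencil_direction_pos (hF : ∀ s, (F s).Splits)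
    (hc : ∀ s j, (F s).coeff j = a j + s * b j)
    (ha0 : a 0 = 1) (hb0 : b 0 = 0) (hb1 : b 1 = 1) {m : ℕ}
    (ha : ∀ p, 1 ≤ p → p ≤ m → 0 < a p) {p : ℕ} (hp : 1 ≤ p) (hpm : p ≤ m) : 0 < b p := by
  induction p using Nat.strong_induction_on with
  | _ p ih =>
    obtain rfl | ⟨j, rfl⟩ : p = 1 ∨ ∃ j, p = j + 2 := by
      rcases p with _ | _ | j
      · omega
      · simp
      · exact .inr ⟨j, rfl⟩
    · simp [hb1]
    have h := pencil_mul_le_mul hF hc ha0 hb0 hb1 (j + 1)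
      fun i h1 h2 => ih i (by omega) h1 (by omega)
    have h1 := mul_pos (ha (j + 2) (by omega) hpm) (ih (j + 1) (by omega) (by omega) (by omega))
    exact pos_of_mul_pos_right (h1.trans_le h) (ha (j + 1) (by omega) (by omega)).le

theorem pencil_base_pos (hF : ∀ s, (F s).Splits)
    (hc : ∀ s j, (F s).coeff j = a j + s * b j)
    (ha0 : a 0 = 1) (hb0 : b 0 = 0) (hb1 : b 1 = 1) {m : ℕ}
    (hb : ∀ p, 1 ≤ p → p ≤ m → 0 < b p) (ham : 0 < a m) {p : ℕ} (hp : 1 ≤ p) (hpm : p ≤ m) :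
    0 < a p := by
  induction hpm using Nat.decreasingInduction with
  | self => exact ham
  | of_succ k hk ih =>
    have h := pencil_mul_le_mul hF hc ha0 hb0 hb1 k fun i h1 h2 => hb i h1 (by omega)
    have h1 := mul_pos (ih (by omega)) (hb k hp hk.le)
    exact pos_of_mul_pos_left (h1.trans_le h) (hb (k + 1) (by omega) hk).le

end Pencil

namespace Matrix

theorem ptrace_zero {ι : Type*} [Fintype ι] (S : Matrix ι ι ℝ) : ptrace 0 S = 1 := by
  simp [ptrace]

variable {ι κ : Type*} [Fintype ι] [DecidableEq ι] [Fintype κ] [DecidableEq κ]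

/-- The polynomial `det (1 + X S)`, whose coefficients are the `p`-traces of `S`. -/
noncomputable def ptracePoly (S : Matrix ι ι ℝ) : ℝ[X] := (1 + (X : ℝ[X]) • S.map C).det

theorem coeff_ptracePoly (S : Matrix ι ι ℝ) (p : ℕ) : S.ptracePoly.coeff p = ptrace p S := by
  rw [ptracePoly, coeff_det_one_add_X_smul_eq_sum_minors, ptrace]
  refine Finset.sum_congr rfl fun t _ => ?_
  congr!

theorem ptracePoly_mul_comm (A : Matrix ι κ ℝ) (B : Matrix κ ι ℝ) :
    (A * B).ptracePoly = (B * A).ptracePoly := by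
  rw [ptracePoly, ptracePoly, Matrix.map_mul, Matrix.map_mul, ← Matrix.smul_mul,
    det_one_add_mul_comm, Matrix.mul_smul]

theorem ptracePoly_diagonal (d : ι → ℝ) :
    (diagonal d).ptracePoly = ∏ i, (1 + C (d i) * X) := by
  rw [ptracePoly, diagonal_map (map_zero C), ← diagonal_smul, ← diagonal_one, diagonal_add,
    det_diagonal]
  simp [mul_comm X]

theorem IsSymm.splits_ptracePoly {S : Matrix ι ι ℝ} (hS : S.IsSymm) : S.ptracePoly.Splits := by
  have hH : S.IsHermitian := by rwa [IsHermitian, conjTranspose_eq_transpose_of_trivial]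
  rw [hH.spectral_theorem, Unitary.conjStarAlgAut_apply, mul_assoc, ptracePoly_mul_comm, mul_assoc,
    Unitary.coe_star_mul_self, mul_one, ptracePoly_diagonal]
  refine Splits.prod fun i _ => Splits.of_natDegree_le_one ?_
  compute_degree

theorem ptracePoly_fromBlocks_add (B : Matrix κ κ ℝ) (u : Matrix κ Unit ℝ) (w : Matrix Unit κ ℝ)
    (D : Matrix Unit Unit ℝ) (s : ℝ) :
    (fromBlocks B u w (D + s • 1)).ptracePoly
      = (fromBlocks B u w D).ptracePoly + C s * X * B.ptracePoly := by
  let M (D : Matrix Unit Unit ℝ) : Matrix (κ ⊕ Unit) (κ ⊕ Unit) ℝ[X] :=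
    1 + (X : ℝ[X]) • (fromBlocks B u w D).map C
  have hM : M (D + s • 1)
      = (M D).updateRow (Sum.inr ()) (M D (Sum.inr ()) + Sum.elim (0 : κ → ℝ[X]) fun _ => C s * X) := by
    ext i j
    rcases i with i | i <;> rcases j with j | j <;>
      simp [M, updateRow_apply, one_apply, mul_add, add_assoc]
  have hB : (M D).updateRow (Sum.inr ()) (Sum.elim (0 : κ → ℝ[X]) fun _ => C s * X)
      = fromBlocks (1 + (X : ℝ[X]) • B.map C) ((X : ℝ[X]) • u.map C) 0
        (of fun _ _ => C s * X) := by
    ext i j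
    rcases i with i | i <;> rcases j with j | j <;>
      simp [M, updateRow_apply, one_apply]
  change (M (D + s • 1)).det = (M D).det + _
  rw [hM, det_updateRow_add, updateRow_eq_self, hB, det_fromBlocks_zero₂₁, ptracePoly, mul_comm]
  simp

/-- A matrix with orthonormal columns and one row more than columns is, up to a column, an
orthogonal matrix. -/
theorem exists_fromCols_mul_transpose_eq_one (hcard : Fintype.card ι = Fintype.card κ + 1)
    {A : Matrix ι κ ℝ} (hA : Aᵀ * A = 1) :
    ∃ v : Matrix ι Unit ℝ, fromCols A v * (fromCols A v)ᵀ = 1 := by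
  let c : κ ⊕ Unit → EuclideanSpace ℝ ι := Sum.elim (fun k => WithLp.toLp 2 (A.col k)) 0
  have hc : Orthonormal ℝ ((Set.range Sum.inl).domRestrict c) := by
    rw [orthonormal_iff_ite]
    rintro ⟨_, i, rfl⟩ ⟨_, j, rfl⟩
    have h := congrFun (congrFun hA j) i
    simp only [mul_apply, transpose_apply, one_apply] at h
    simp [c, PiLp.inner_apply, h, eq_comm, Subtype.ext_iff]
  obtain ⟨b, hb⟩ := hc.exists_orthonormalBasis_extension_of_card_eq (by simp [hcard])
  refine ⟨of fun i _ => b (Sum.inr ()) i, ?_⟩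
  have hQ : fromCols A (of fun i _ => b (Sum.inr ()) i) = of fun i j => b j i := by
    ext i (j | j)
    · simp [hb (Sum.inl j) ⟨j, rfl⟩, c]
    · rfl
  rw [hQ]
  refine (mul_eq_one_comm_of_card_eq (κ ⊕ Unit) ι ℝ (by simp [hcard])).1 ?_
  ext i j
  have h := orthonormal_iff_ite.1 b.orthonormal j i
  simpa [mul_apply, one_apply, PiLp.inner_apply, eq_comm] using h

/-- One compression step of the modified Sylvester criterion. -/
theorem forall_ptrace_pos_iff_compression (hcard : Fintype.card ι = Fintype.card κ + 1)
    {S : Matrix ι ι ℝ} (hS : S.IsSymm) {A : Matrix ι κ ℝ} (hA : Aᵀ * A = 1) (m : ℕ) :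
    (∀ p, 1 ≤ p → p ≤ m + 1 → 0 < ptrace p S) ↔
      0 < ptrace (m + 1) S ∧ ∀ p, 1 ≤ p → p ≤ m → 0 < ptrace p (Aᵀ * S * A) := by
  obtain ⟨v, hv⟩ := exists_fromCols_mul_transpose_eq_one hcard hA
  set B := Aᵀ * S * A with hB
  let S' (s : ℝ) : Matrix (κ ⊕ Unit) (κ ⊕ Unit) ℝ :=
    fromBlocks B (Aᵀ * S * v) (vᵀ * S * A) (vᵀ * S * v + s • 1)
  have hQ : (fromCols A v)ᵀ * S * fromCols A v = S' 0 := by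
    simp [S', hB, transpose_fromCols, fromRows_mul]
  have hS' (s : ℝ) : (S' s).IsSymm := by
    simp [S', hB, IsSymm, fromBlocks_transpose, transpose_mul, hS.eq, Matrix.mul_assoc]
  have hpoly : (S' 0).ptracePoly = S.ptracePoly := by
    rw [← hQ, Matrix.mul_assoc, ptracePoly_mul_comm, Matrix.mul_assoc, hv, Matrix.mul_one]
  let b : ℕ → ℝ := fun j => (X * B.ptracePoly).coeff j
  have hc (s : ℝ) (j : ℕ) : (S' s).ptracePoly.coeff j = ptrace j S + s * b j := by
    have h0 : (S' 0).ptracePoly = _ := ptracePoly_fromBlocks_add _ _ _ _ 0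
    rw [hpoly] at h0
    rw [← coeff_ptracePoly, h0]
    simp only [S', b]
    rw [ptracePoly_fromBlocks_add, mul_assoc]
    simp
  have hF (s : ℝ) := (hS' s).splits_ptracePoly
  have hb (j : ℕ) : b (j + 1) = ptrace j B := by simp [b, coeff_ptracePoly]
  have hb0 : b 0 = 0 := by simp [b]
  have hb1 : b 1 = 1 := by rw [hb, ptrace_zero]
  have hbpos : (∀ p, 1 ≤ p → p ≤ m → 0 < ptrace p B) ↔ ∀ p, 1 ≤ p → p ≤ m + 1 → 0 < b p := by
    constructor
    · rintro h (_ | _ | p) h1 h2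
      · omega
      · simp [hb1]
      · rw [hb]
        exact h _ (by omega) (by omega)
    · intro h p h1 h2
      rw [← hb]
      exact h _ (by omega) (by omega)
  rw [hbpos]
  constructor
  · intro h
    exact ⟨h _ (by omega) le_rfl, fun p =>
      pencil_direction_pos hF hc (ptrace_zero S) hb0 hb1 h⟩
  · rintro ⟨h1, h2⟩ p
    exact pencil_base_pos hF hc (ptrace_zero S) hb0 hb1 h2 h1

end Matrix

end

/-- modified Sylvester criterion, chain form: let `S` be a real symmetric
`n × n` matrix, `1 ≤ m ≤ n`. Given matrices `A k` of size `(n-k) × (n-(k+1))` with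
`(A k)ᵀ (A k) = I` (for `k = 0, …, m-2`, i.e. the paper's `A_{k+1}`), and the chain
`T 0 = S`, `T (k+1) = (A k)ᵀ (T k) (A k)`, one has `S ∈ K_m(n)` iff `T_m(S) > 0` and
`T_{m-k}(S_k) > 0` for every `1 ≤ k ≤ m-1`. -/
theorem modified_sylvester_chain (n m : ℕ) (h1 : 1 ≤ m) (h2 : m ≤ n)
    (S : Matrix (Fin n) (Fin n) ℝ) (hS : S.IsSymm)
    (A : ∀ k : ℕ, Matrix (Fin (n - k)) (Fin (n - (k + 1))) ℝ)
    (hA : ∀ k : ℕ, k + 1 ≤ m - 1 → (A k)ᵀ * A k = 1)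
    (T : ∀ k : ℕ, Matrix (Fin (n - k)) (Fin (n - k)) ℝ)
    (hT0 : T 0 = S)
    (hTk : ∀ k : ℕ, k + 1 ≤ m - 1 → T (k + 1) = (A k)ᵀ * T k * A k) :
    S ∈ gardingCone n m ↔
      (0 < ptrace m S ∧ ∀ k : ℕ, 1 ≤ k → k ≤ m - 1 → 0 < ptrace (m - k) (T k)) := by
  have hsymm : ∀ k, k ≤ m - 1 → (T k).IsSymm := by
    intro k
    induction k with
    | zero => exact fun _ => hT0 ▸ hS
    | succ k ih =>
      intro hk
      rw [hTk k hk, Matrix.IsSymm]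
      simp [Matrix.transpose_mul, (ih (by omega)).eq, Matrix.mul_assoc]
  have hchain : ∀ j, j ≤ m - 1 → ((∀ p, 1 ≤ p → p ≤ m - j → 0 < ptrace p (T j)) ↔
      ∀ k, j ≤ k → k ≤ m - 1 → 0 < ptrace (m - k) (T k)) := by
    intro j hj
    induction hj using Nat.decreasingInduction with
    | self =>
      constructor
      · intro h k h1 h2
        obtain rfl := le_antisymm h1 h2
        exact h _ (by omega) le_rfl
      · intro h p hp1 hp2
        obtain rfl : p = m - (m - 1) := by omega
        exact h _ le_rfl le_rfl
    | of_succ j hj ih =>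
      have hstep := Matrix.forall_ptrace_pos_iff_compression (by simp; omega) (hsymm j hj.le) (hA j hj)
        (m - (j + 1))
      rw [← hTk j hj, ih, show m - (j + 1) + 1 = m - j by omega] at hstep
      rw [hstep]
      constructor
      · rintro ⟨h1, h2⟩ k hk1 hk2
        obtain rfl | hlt := hk1.eq_or_lt
        · exact h1
        · exact h2 k hlt hk2
      · exact fun h => ⟨h j le_rfl hj.le, fun k hk1 hk2 => h k (by omega) hk2⟩
  have h := hchain 0 (by omega)
  simp only [Nat.sub_zero, hT0] at h
  constructor
  · rintro ⟨-, hpos⟩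
    exact ⟨hpos m h1 le_rfl, fun k _ hk => h.1 hpos k k.zero_le hk⟩
  · rintro ⟨hm, hpos⟩
    refine ⟨hS, h.2 fun k _ hk => ?_⟩
    rcases k with _ | k
    · simpa [hT0] using hm
    · exact hpos _ (by omega) hk
end
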